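/- There is a universal constant C > 0 such that for every real p ≥ 2 and every integer n ≥ 2, every n-point subset M of the sequence space ℓ_p, and every Δ > 0, the metric space M admits a (C·p^4·√(log n), Δ)-Lipschitz decomposition. -/

import Mathlib

noncomputable section

open scoped NNReal ENNReal

/-- A `(β, Δ)`-Lipschitz decomposition of a (pseudo)metric space `α`: a probability
distribution over partitions of `α` (encoded as equivalence relations / setoids) such that
every cluster of every partition in the support has diameter at most `Δ` (i.e. any two
equivalent points are at distance at most `Δ`), and any two points `x, y` are separated
(put in different clusters) with probability at most `β * dist x y / Δ`. -/
def LipschitzDecomp (α : Type*) [PseudoMetricSpace α] (β Δ : ℝ) : Prop :=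
  ∃ D : PMF (Setoid α),
    (∀ R ∈ D.support, ∀ x y : α, R.r x y → dist x y ≤ Δ) ∧
    (∀ x y : α, D.toOuterMeasure {R | ¬ R.r x y} ≤ ENNReal.ofReal (β * dist x y / Δ))

open MeasureTheory

/-- The setoid in which the members of `A` form one class and the complement of `A` is divided
according to `R`. -/
def Setoid.carve {α : Type*} (A : Finset α) (R : Setoid α) : Setoid α where
  r x y := (x ∈ A ∧ y ∈ A) ∨ (x ∉ A ∧ y ∉ A ∧ R.r x y)
  iseqv :=
    { refl := fun x => by
        by_cases hx : x ∈ A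
        · exact Or.inl ⟨hx, hx⟩
        · exact Or.inr ⟨hx, hx, R.refl x⟩
      symm := by
        rintro x y (⟨hx, hy⟩ | ⟨hx, hy, h⟩)
        · exact Or.inl ⟨hy, hx⟩
        · exact Or.inr ⟨hy, hx, R.symm h⟩
      trans := by
        rintro x y z (⟨hx, hy⟩ | ⟨hx, hy, h⟩) (⟨hy', hz⟩ | ⟨hy', hz, h'⟩)
        · exact Or.inl ⟨hx, hz⟩
        · exact absurd hy hy'
        · exact absurd hy' hy
        · exact Or.inr ⟨hx, hz, R.trans h h'⟩ }

theorem Setoid.carve_apply {α : Type*} (A : Finset α) (R : Setoid α) (x y : α) :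
    Setoid.carve A R x y ↔ (x ∈ A ∧ y ∈ A) ∨ (x ∉ A ∧ y ∉ A ∧ R x y) :=
  Iff.rfl

/-- Iteratively carving out sets drawn with probability proportional to the weights `w`
produces a random partition that separates two points with probability at most the ratio between
the weight of the sets that separate them and the weight of the sets that hit them. -/
theorem exists_pmf_setoid_of_weights {α : Type*} [Fintype α] [DecidableEq α]
    (w : Finset α → ℝ≥0∞) (hw : ∀ A, w A ≠ ⊤) (hcov : ∀ x, ∃ A, x ∈ A ∧ w A ≠ 0)
    (P : α → α → Prop) (hP : ∀ A, w A ≠ 0 → ∀ x ∈ A, ∀ y ∈ A, P x y)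
    (σ : α → α → ℝ≥0∞)
    (hσ : ∀ x y, ∑ A with ¬ (x ∈ A ↔ y ∈ A), w A ≤ σ x y * ∑ A with (x ∈ A ∨ y ∈ A), w A) :
    ∃ D : PMF (Setoid α), (∀ R ∈ D.support, ∀ x y, R.r x y → P x y) ∧
      ∀ x y, D.toOuterMeasure {R | ¬ R.r x y} ≤ σ x y := by
  classical
  suffices H : ∀ S : Finset α, ∃ D : PMF (Setoid α),
      (∀ R ∈ D.support, ∀ x ∈ S, ∀ y ∈ S, R.r x y → P x y) ∧
      ∀ x ∈ S, ∀ y ∈ S, D.toOuterMeasure {R | ¬ R.r x y} ≤ σ x y by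
    simpa using H Finset.univ
  intro S
  induction S using Finset.strongInduction with
  | H S ih =>
  rcases S.eq_empty_or_nonempty with rfl | ⟨x₀, hx₀⟩
  · exact ⟨PMF.pure ⊤, by simp, by simp⟩
  have ih' : ∀ A : Finset α, ∃ D : PMF (Setoid α), (A ∩ S).Nonempty →
      (∀ R ∈ D.support, ∀ x ∈ S \ A, ∀ y ∈ S \ A, R.r x y → P x y) ∧
      ∀ x ∈ S \ A, ∀ y ∈ S \ A, D.toOuterMeasure {R | ¬ R.r x y} ≤ σ x y := by
    intro A
    by_cases hA : (A ∩ S).Nonempty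
    · obtain ⟨z, hz⟩ := hA
      rw [Finset.mem_inter] at hz
      obtain ⟨D, hD⟩ := ih (S \ A) (Finset.ssubset_iff_subset_ne.2
        ⟨Finset.sdiff_subset, fun h => (Finset.mem_sdiff.1 (h.symm ▸ hz.2)).2 hz.1⟩)
      exact ⟨D, fun _ => hD⟩
    · exact ⟨PMF.pure ⊤, fun h => absurd h hA⟩
  choose g hg using ih'
  obtain ⟨f, hf⟩ : ∃ f : Finset α → ℝ≥0∞, ∀ A, f A = if (A ∩ S).Nonempty then w A else 0 :=
    ⟨_, fun _ => rfl⟩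
  have hf0 : tsum f ≠ 0 := by
    obtain ⟨A, hxA, hwA⟩ := hcov x₀
    intro h
    have := ENNReal.tsum_eq_zero.1 h A
    rw [hf, if_pos ⟨x₀, Finset.mem_inter.2 ⟨hxA, hx₀⟩⟩] at this
    exact hwA this
  have hftop : tsum f ≠ ⊤ := by
    rw [tsum_fintype]
    refine ENNReal.sum_ne_top.2 fun A _ => ?_
    rw [hf]
    split_ifs
    · exact hw A
    · simp
  refine ⟨(PMF.normalize f hf0 hftop).bind fun A => (g A).map (Setoid.carve A), ?_, ?_⟩
  · intro R hR x hx y hy hxy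
    simp only [PMF.mem_support_bind_iff, PMF.mem_support_normalize_iff,
      PMF.mem_support_map_iff] at hR
    obtain ⟨A, hA, R', hR', rfl⟩ := hR
    have hne : (A ∩ S).Nonempty := by
      by_contra h
      exact hA (by rw [hf, if_neg h])
    have hwA : w A ≠ 0 := by
      simpa only [hf, if_pos hne] using hA
    rcases hxy with ⟨h1, h2⟩ | ⟨h1, h2, h3⟩
    · exact hP A hwA x h1 y h2
    · exact (hg A hne).1 R' hR' x (Finset.mem_sdiff.2 ⟨hx, h1⟩) y (Finset.mem_sdiff.2 ⟨hy, h2⟩) h3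
  · intro x hx y hy
    rw [PMF.toOuterMeasure_bind_apply, tsum_fintype]
    simp only [PMF.normalize_apply, PMF.toOuterMeasure_map_apply]
    have key : ∀ A, f A * (g A).toOuterMeasure (Setoid.carve A ⁻¹' {R | ¬ R.r x y}) ≤
        (if ¬ (x ∈ A ↔ y ∈ A) then w A else 0) +
          σ x y * (if ¬ (x ∈ A ∨ y ∈ A) then f A else 0) := by
      intro A
      have hfw : f A ≤ w A := by
        rw [hf]
        split_ifs <;> simp
      have hone : (g A).toOuterMeasure (Setoid.carve A ⁻¹' {R | ¬ R.r x y}) ≤ 1 :=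
        ((g A).toOuterMeasure.mono (Set.subset_univ _)).trans
          ((PMF.toOuterMeasure_apply_eq_one_iff _ _).2 (Set.subset_univ _)).le
      by_cases hsep : x ∈ A ↔ y ∈ A
      · by_cases hxA : x ∈ A
        · have hyA := hsep.1 hxA
          have : Setoid.carve A ⁻¹' {R | ¬ R.r x y} = ∅ := by
            ext R
            simp [Setoid.carve_apply, hxA, hyA]
          simp [this]
        · have hyA : y ∉ A := fun h => hxA (hsep.2 h)
          by_cases hne : (A ∩ S).Nonempty
          · have : Setoid.carve A ⁻¹' {R | ¬ R.r x y} = {R | ¬ R.r x y} := by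
              ext R
              simp [Setoid.carve_apply, hxA, hyA]
            rw [this, if_neg (not_not.2 hsep), if_pos (by tauto), zero_add, mul_comm]
            gcongr
            exact (hg A hne).2 x (Finset.mem_sdiff.2 ⟨hx, hxA⟩) y (Finset.mem_sdiff.2 ⟨hy, hyA⟩)
          · simp [hf, hne]
      · rw [if_pos hsep]
        calc _ ≤ w A * 1 := by gcongr
          _ ≤ _ := by simp
    calc ∑ A, f A * (∑' A, f A)⁻¹ *
          (g A).toOuterMeasure (Setoid.carve A ⁻¹' {R | ¬ R.r x y})
        = (∑ A, f A * (g A).toOuterMeasure (Setoid.carve A ⁻¹' {R | ¬ R.r x y})) *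
            (∑' A, f A)⁻¹ := by
          rw [Finset.sum_mul]
          exact Finset.sum_congr rfl fun A _ => by ring
      _ ≤ (σ x y * ∑' A, f A) * (∑' A, f A)⁻¹ := by
          gcongr
          refine (Finset.sum_le_sum fun A _ => key A).trans ?_
          rw [Finset.sum_add_distrib, ← Finset.mul_sum, ← Finset.sum_filter]
          refine (add_le_add_left (hσ x y) _).trans ?_
          rw [← mul_add, Finset.sum_filter, ← Finset.sum_add_distrib, tsum_fintype]
          gcongr with A
          by_cases h : x ∈ A ∨ y ∈ A
          · have : (A ∩ S).Nonempty := by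
              rcases h with h | h
              exacts [⟨x, Finset.mem_inter.2 ⟨h, hx⟩⟩, ⟨y, Finset.mem_inter.2 ⟨h, hy⟩⟩]
            simp [h, hf, this]
          · simp [h]
      _ = σ x y := by
          rw [mul_assoc, ENNReal.mul_inv_cancel hf0 hftop, mul_one]

section Gaussian

variable {E : Type*} [NormedAddCommGroup E]

/-- The unnormalised square root of the standard Gaussian density centred at `x`. -/
def gaussianBump (x z : E) : ℝ := Real.exp (-‖z - x‖ ^ 2 / 4)

theorem gaussianBump_nonneg (x z : E) : 0 ≤ gaussianBump x z := (Real.exp_pos _).le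

theorem continuous_gaussianBump (x : E) : Continuous (gaussianBump x) := by
  unfold gaussianBump
  fun_prop

/-- The region under the graph of the Gaussian density centred at `x`. -/
def gaussianRegion (x : E) : Set (E × ℝ) :=
  regionBetween 0 (fun z => gaussianBump x z * gaussianBump x z) Set.univ

theorem gaussianRegion_inter (x y : E) :
    gaussianRegion x ∩ gaussianRegion y = regionBetween 0 (fun z =>
      min (gaussianBump x z * gaussianBump x z) (gaussianBump y z * gaussianBump y z))
        Set.univ := by
  ext ⟨z, t⟩
  simp only [gaussianRegion, regionBetween, Set.mem_inter_iff, Set.mem_ofPred_eq, Set.mem_Ioo,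
    lt_min_iff]
  tauto

variable [MeasurableSpace E] [BorelSpace E]

theorem measurableSet_gaussianRegion (x : E) : MeasurableSet (gaussianRegion x) :=
  measurableSet_regionBetween measurable_const
    ((continuous_gaussianBump x).mul (continuous_gaussianBump x)).measurable MeasurableSet.univ

variable [InnerProductSpace ℝ E]

omit [MeasurableSpace E] [BorelSpace E] in
theorem gaussianBump_mul (x y z : E) :
    gaussianBump x z * gaussianBump y z = Real.exp (-‖x - y‖ ^ 2 / 8) *
      Real.exp (-(1 / 2) * ‖z - (1 / 2 : ℝ) • (x + y)‖ ^ 2) := by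
  unfold gaussianBump
  rw [← Real.exp_add, ← Real.exp_add]
  congr 1
  have h := parallelogram_law_with_norm ℝ (z - x) (z - y)
  have h1 : z - x + (z - y) = (2 : ℝ) • (z - (1 / 2 : ℝ) • (x + y)) := by
    module
  have h2 : z - x - (z - y) = -(x - y) := by abel
  rw [h1, h2, norm_neg, norm_smul, Real.norm_ofNat] at h
  nlinarith

variable [FiniteDimensional ℝ E]

theorem integral_gaussian_pos : 0 < ∫ z : E, Real.exp (-(1 / 2) * ‖z‖ ^ 2) := by
  rw [GaussianFourier.integral_rexp_neg_mul_sq_norm (by norm_num)]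
  positivity

theorem integrable_gaussian : Integrable fun z : E => Real.exp (-(1 / 2) * ‖z‖ ^ 2) :=
  Integrable.of_integral_ne_zero integral_gaussian_pos.ne'

theorem integrable_gaussianBump_mul (x y : E) :
    Integrable fun z : E => gaussianBump x z * gaussianBump y z := by
  simp only [gaussianBump_mul]
  exact (integrable_gaussian.comp_sub_right _).const_mul _

theorem integral_gaussianBump_mul (x y : E) :
    ∫ z : E, gaussianBump x z * gaussianBump y z =
      Real.exp (-‖x - y‖ ^ 2 / 8) * ∫ z : E, Real.exp (-(1 / 2) * ‖z‖ ^ 2) := by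
  simp only [gaussianBump_mul]
  rw [integral_const_mul,
    integral_sub_right_eq_self (fun z : E => Real.exp (-(1 / 2) * ‖z‖ ^ 2))]

theorem integral_gaussianBump_sq (x : E) :
    ∫ z : E, gaussianBump x z * gaussianBump x z = ∫ z : E, Real.exp (-(1 / 2) * ‖z‖ ^ 2) := by
  simp [integral_gaussianBump_mul]

theorem volume_gaussianRegion (x : E) :
    volume (gaussianRegion x) = ENNReal.ofReal (∫ z : E, Real.exp (-(1 / 2) * ‖z‖ ^ 2)) := by
  rw [Measure.volume_eq_prod, gaussianRegion, volume_regionBetween_eq_integral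
    (integrable_zero _ _ _).integrableOn (integrable_gaussianBump_mul x x).integrableOn
    MeasurableSet.univ (fun z _ => mul_self_nonneg _), setIntegral_univ,
    ← integral_gaussianBump_sq x]
  simp

theorem integrable_min_gaussianBump (x y : E) : Integrable fun z : E =>
    min (gaussianBump x z * gaussianBump x z) (gaussianBump y z * gaussianBump y z) :=
  (integrable_gaussianBump_mul x x).inf (integrable_gaussianBump_mul y y)

theorem volume_gaussianRegion_inter_eq (x y : E) :
    volume (gaussianRegion x ∩ gaussianRegion y) = ENNReal.ofReal (∫ z : E,
      min (gaussianBump x z * gaussianBump x z) (gaussianBump y z * gaussianBump y z)) := by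
  rw [Measure.volume_eq_prod, gaussianRegion_inter, volume_regionBetween_eq_integral
    (integrable_zero _ _ _).integrableOn (integrable_min_gaussianBump x y).integrableOn
    MeasurableSet.univ (fun z _ => le_min (mul_self_nonneg _) (mul_self_nonneg _)),
    setIntegral_univ]
  simp

theorem volume_gaussianRegion_inter_le (x y : E) :
    volume (gaussianRegion x ∩ gaussianRegion y) ≤ ENNReal.ofReal
      (Real.exp (-‖x - y‖ ^ 2 / 8) * ∫ z : E, Real.exp (-(1 / 2) * ‖z‖ ^ 2)) := by
  rw [volume_gaussianRegion_inter_eq, ← integral_gaussianBump_mul]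
  refine ENNReal.ofReal_le_ofReal (integral_mono (integrable_min_gaussianBump x y)
    (integrable_gaussianBump_mul x y) fun z => ?_)
  have hx := gaussianBump_nonneg x z
  have hy := gaussianBump_nonneg y z
  rcases le_total (gaussianBump x z) (gaussianBump y z) with h | h
  · exact (min_le_left _ _).trans (by dsimp only; gcongr)
  · exact (min_le_right _ _).trans (by dsimp only; gcongr)

theorem volume_gaussianRegion_diff_le (x y : E) :
    volume (gaussianRegion x \ gaussianRegion y) ≤ ENNReal.ofReal
      (‖x - y‖ * ∫ z : E, Real.exp (-(1 / 2) * ‖z‖ ^ 2)) := by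
  rcases eq_or_ne x y with rfl | hxy
  · simp
  have hd : 0 < ‖x - y‖ := norm_pos_iff.2 (sub_ne_zero.2 hxy)
  set d := ‖x - y‖ with hdd
  set I := ∫ z : E, Real.exp (-(1 / 2) * ‖z‖ ^ 2) with hI
  have hIpos : 0 < I := integral_gaussian_pos
  rw [← Set.sdiff_inter_self_eq_sdiff, Set.inter_comm, measure_sdiff Set.inter_subset_left
    ((measurableSet_gaussianRegion x).inter (measurableSet_gaussianRegion y)).nullMeasurableSet
    (by rw [volume_gaussianRegion_inter_eq]; exact ENNReal.ofReal_ne_top),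
    volume_gaussianRegion, volume_gaussianRegion_inter_eq, ← ENNReal.ofReal_sub _
      (integral_nonneg fun z => le_min (mul_self_nonneg _) (mul_self_nonneg _)),
    ← integral_gaussianBump_sq x, ← integral_sub (integrable_gaussianBump_mul x x)
      (integrable_min_gaussianBump x y)]
  refine ENNReal.ofReal_le_ofReal ?_
  have hxx := integrable_gaussianBump_mul x x
  have hyy := integrable_gaussianBump_mul y y
  have hxy' := integrable_gaussianBump_mul x y
  have hexp : 1 - d ^ 2 / 8 ≤ Real.exp (-d ^ 2 / 8) := by
    have := Real.add_one_le_exp (-d ^ 2 / 8)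
    linarith
  have hexp1 : Real.exp (-d ^ 2 / 8) ≤ 1 := Real.exp_le_one_iff.2 (by nlinarith)
  have hsum : Integrable fun z : E =>
      (2 / d + d / 8) * (gaussianBump x z * gaussianBump x z) +
        (2 / d + d / 8) * (gaussianBump y z * gaussianBump y z) :=
    (hxx.const_mul _).add (hyy.const_mul _)
  calc _ ≤ ∫ z : E, ((2 / d + d / 8) * (gaussianBump x z * gaussianBump x z) +
          (2 / d + d / 8) * (gaussianBump y z * gaussianBump y z)) -
          (4 / d - d / 4) * (gaussianBump x z * gaussianBump y z) := by
        refine integral_mono (hxx.sub (integrable_min_gaussianBump x y))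
          (hsum.sub (hxy'.const_mul _)) fun z => ?_
        dsimp only
        generalize gaussianBump x z = a
        generalize gaussianBump y z = b
        have h1 : a * a - min (a * a) (b * b) ≤ |a - b| * |a + b| := by
          rw [← abs_mul]
          rcases min_choice (a * a) (b * b) with h | h
          · rw [h, sub_self]
            exact abs_nonneg _
          · rw [h]
            refine le_trans (le_of_eq ?_) (le_abs_self _)
            ring
        have h2 : |a - b| * |a + b| ≤ 2 / d * (a - b) ^ 2 + d / 8 * (a + b) ^ 2 := by
          rw [← sq_abs (a - b), ← sq_abs (a + b)]
          have : 2 / d * |a - b| ^ 2 + d / 8 * |a + b| ^ 2 - |a - b| * |a + b| =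
              2 / d * (|a - b| - d / 4 * |a + b|) ^ 2 := by
            field_simp
            ring
          have h3 : 0 ≤ 2 / d * (|a - b| - d / 4 * |a + b|) ^ 2 := by positivity
          linarith
        refine (h1.trans h2).trans (le_of_eq ?_)
        ring
    _ = (4 / d + d / 4 - (4 / d - d / 4) * Real.exp (-d ^ 2 / 8)) * I := by
        rw [integral_sub hsum (hxy'.const_mul _),
          integral_add (hxx.const_mul _) (hyy.const_mul _), integral_const_mul,
          integral_const_mul, integral_const_mul, integral_gaussianBump_sq,
          integral_gaussianBump_sq, integral_gaussianBump_mul]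
        ring
    _ ≤ d * I := by
        gcongr
        have h4 : 4 / d * (1 - d ^ 2 / 8) = 4 / d - d / 2 := by
          field_simp
          ring
        have h5 : 4 / d * (1 - d ^ 2 / 8) ≤ 4 / d * Real.exp (-d ^ 2 / 8) := by gcongr
        nlinarith

end Gaussian

theorem measurableSet_filter_mem_eq {Ω α : Type*} [MeasurableSpace Ω] [Fintype α]
    [DecidableEq α] {U : α → Set Ω} (hU : ∀ x, MeasurableSet (U x))
    [∀ ω, DecidablePred fun x => ω ∈ U x] (A : Finset α) :
    MeasurableSet ((fun ω => Finset.univ.filter fun x => ω ∈ U x) ⁻¹' {A}) := by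
  have : (fun ω => Finset.univ.filter fun x => ω ∈ U x) ⁻¹' {A} =
      ⋂ x, if x ∈ A then U x else (U x)ᶜ := by
    ext ω
    simp only [Set.mem_preimage, Set.mem_singleton_iff, Finset.ext_iff, Finset.mem_filter,
      Finset.mem_univ, true_and, Set.mem_iInter]
    refine forall_congr' fun x => ?_
    split_ifs with h <;> simp [h]
  rw [this]
  refine MeasurableSet.iInter fun x => ?_
  split_ifs
  exacts [hU x, (hU x).compl]

/-- A finite family of points of a Euclidean space has a random partition into clusters of
diameter `O(√(log n))` that separates two points with probability proportional to their distance. -/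
theorem exists_pmf_setoid_euclidean {E : Type*} [NormedAddCommGroup E] [InnerProductSpace ℝ E]
    [FiniteDimensional ℝ E] {α : Type*} [Fintype α] (F : α → E) (r : ℝ) (hr : 0 < r)
    (hcard : Fintype.card α * Real.exp (-(r / 2) ^ 2 / 8) ≤ 1 / 2) :
    ∃ D : PMF (Setoid α), (∀ R ∈ D.support, ∀ x y, R.r x y → ‖F x - F y‖ ≤ r) ∧
      ∀ x y, D.toOuterMeasure {R | ¬ R.r x y} ≤ ENNReal.ofReal (4 * ‖F x - F y‖) := by
  classical
  borelize E
  set I := ∫ z : E, Real.exp (-(1 / 2) * ‖z‖ ^ 2) with hI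
  have hIpos : 0 < I := integral_gaussian_pos
  let S : E × ℝ → Finset α := fun ω => Finset.univ.filter fun x => ω ∈ gaussianRegion (F x)
  have hS : ∀ ω x, x ∈ S ω ↔ ω ∈ gaussianRegion (F x) := by simp [S]
  have hSm : ∀ A, MeasurableSet (S ⁻¹' {A}) :=
    measurableSet_filter_mem_eq fun x => measurableSet_gaussianRegion (F x)
  let good : Finset α → Prop := fun A => ∀ x ∈ A, ∀ y ∈ A, ‖F x - F y‖ ≤ r
  obtain ⟨w, hw⟩ : ∃ w : Finset α → ℝ≥0∞, ∀ A, w A =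
      if good A ∧ A.Nonempty then volume (S ⁻¹' {A}) else 0 := ⟨_, fun _ => rfl⟩
  have hhit : ∀ x, ENNReal.ofReal (I / 2) ≤ ∑ A with x ∈ A, w A := by
    intro x
    have hsub : gaussianRegion (F x) ⊆ (⋃ A ∈ Finset.univ.filter fun A => x ∈ A ∧ good A,
        S ⁻¹' {A}) ∪ ⋃ u ∈ Finset.univ.filter fun u => r / 2 ≤ ‖F x - F u‖,
          gaussianRegion (F x) ∩ gaussianRegion (F u) := by
      intro ω hω
      by_cases hg : good (S ω)
      · left
        simp [hS, hg, hω]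
      · right
        simp only [good] at hg
        push Not at hg
        obtain ⟨u, hu, v, hv, huv⟩ := hg
        rw [hS] at hu hv
        have htri : ‖F u - F v‖ ≤ ‖F x - F u‖ + ‖F x - F v‖ := by
          rw [norm_sub_rev (F x) (F u)]
          exact norm_sub_le_norm_sub_add_norm_sub _ _ _
        rcases le_or_gt (r / 2) ‖F x - F u‖ with h | h
        · exact Set.mem_biUnion (x := u) (by simpa using h) ⟨hω, hu⟩
        · exact Set.mem_biUnion (x := v) (by simp; linarith) ⟨hω, hv⟩
    have h1 : volume (⋃ A ∈ Finset.univ.filter fun A => x ∈ A ∧ good A, S ⁻¹' {A}) ≤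
        ∑ A with x ∈ A, w A := by
      refine (measure_biUnion_finset_le _ _).trans ?_
      calc ∑ A with x ∈ A ∧ good A, volume (S ⁻¹' {A})
          = ∑ A with x ∈ A ∧ good A, w A := by
            refine Finset.sum_congr rfl fun A hA => ?_
            have hA' := (Finset.mem_filter.1 hA).2
            rw [hw, if_pos ⟨hA'.2, x, hA'.1⟩]
        _ ≤ ∑ A with x ∈ A, w A :=
            Finset.sum_le_sum_of_subset (Finset.monotone_filter_right _ fun A _ h => h.1)
    have h2 : volume (⋃ u ∈ Finset.univ.filter fun u => r / 2 ≤ ‖F x - F u‖,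
          gaussianRegion (F x) ∩ gaussianRegion (F u)) ≤ ENNReal.ofReal (I / 2) := by
      refine (measure_biUnion_finset_le _ _).trans ?_
      calc _ ≤ ∑ u with r / 2 ≤ ‖F x - F u‖,
              ENNReal.ofReal (Real.exp (-(r / 2) ^ 2 / 8) * I) := by
            refine Finset.sum_le_sum fun u hu => (volume_gaussianRegion_inter_le _ _).trans ?_
            have hu' : r / 2 ≤ ‖F x - F u‖ := (Finset.mem_filter.1 hu).2
            gcongr
        _ ≤ ∑ u : α, ENNReal.ofReal (Real.exp (-(r / 2) ^ 2 / 8) * I) :=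
            Finset.sum_le_sum_of_subset (Finset.filter_subset _ _)
        _ ≤ ENNReal.ofReal (I / 2) := by
            rw [← ENNReal.ofReal_sum_of_nonneg fun _ _ => by positivity]
            refine ENNReal.ofReal_le_ofReal ?_
            rw [Finset.sum_const, nsmul_eq_mul, Finset.card_univ]
            nlinarith
    have h3 := (measure_mono hsub).trans ((measure_union_le _ _).trans (add_le_add h1 h2))
    rw [volume_gaussianRegion, ← hI, ← add_halves I, ENNReal.ofReal_add (by positivity)
      (by positivity), add_halves] at h3
    exact ENNReal.le_of_add_le_add_right ENNReal.ofReal_ne_top h3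
  refine exists_pmf_setoid_of_weights w ?_ ?_ _ ?_ _ ?_
  · intro A
    rw [hw]
    split_ifs with h
    · obtain ⟨x, hx⟩ := h.2
      refine ne_top_of_le_ne_top (b := volume (gaussianRegion (F x))) ?_ (measure_mono ?_)
      · rw [volume_gaussianRegion]
        exact ENNReal.ofReal_ne_top
      · rintro ω rfl
        exact (hS _ _).1 hx
    · simp
  · intro x
    have : ∑ A with x ∈ A, w A ≠ 0 := by
      refine (lt_of_lt_of_le ?_ (hhit x)).ne'
      simpa using hIpos
    obtain ⟨A, hA, hwA⟩ := Finset.exists_ne_zero_of_sum_ne_zero this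
    exact ⟨A, (Finset.mem_filter.1 hA).2, hwA⟩
  · intro A hA
    rw [hw] at hA
    exact (of_not_not fun h => hA (if_neg h) : good A ∧ A.Nonempty).1
  · intro x y
    have hsep : ∑ A with ¬ (x ∈ A ↔ y ∈ A), w A ≤
        ENNReal.ofReal (2 * ‖F x - F y‖ * I) := by
      calc ∑ A with ¬ (x ∈ A ↔ y ∈ A), w A
          ≤ ∑ A with ¬ (x ∈ A ↔ y ∈ A), volume (S ⁻¹' {A}) := by
            refine Finset.sum_le_sum fun A _ => ?_
            rw [hw]
            split_ifs <;> simp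
        _ = volume (S ⁻¹' (Finset.univ.filter fun A => ¬ (x ∈ A ↔ y ∈ A) : Finset (Finset α))) :=
            sum_measure_preimage_singleton _ fun A _ => hSm A
        _ ≤ volume ((gaussianRegion (F x) \ gaussianRegion (F y)) ∪
              (gaussianRegion (F y) \ gaussianRegion (F x))) := by
            refine measure_mono fun ω hω => ?_
            simp only [Finset.coe_filter, Finset.mem_univ, true_and, Set.mem_preimage,
              Set.mem_ofPred_eq, hS] at hω
            simp only [Set.mem_union, Set.mem_sdiff]
            tauto
        _ ≤ ENNReal.ofReal (‖F x - F y‖ * I) + ENNReal.ofReal (‖F y - F x‖ * I) :=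
            (measure_union_le _ _).trans (add_le_add (volume_gaussianRegion_diff_le _ _)
              (volume_gaussianRegion_diff_le _ _))
        _ = ENNReal.ofReal (2 * ‖F x - F y‖ * I) := by
            rw [norm_sub_rev (F y), ← ENNReal.ofReal_add (by positivity) (by positivity)]
            ring_nf
    refine hsep.trans ?_
    calc ENNReal.ofReal (2 * ‖F x - F y‖ * I)
        = ENNReal.ofReal (4 * ‖F x - F y‖) * ENNReal.ofReal (I / 2) := by
          rw [← ENNReal.ofReal_mul (by positivity)]
          ring_nf
      _ ≤ _ := by
          gcongr
          refine (hhit x).trans (Finset.sum_le_sum_of_subset fun A hA => ?_)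
          simp only [Finset.mem_filter, Finset.mem_univ, true_and] at hA ⊢
          exact Or.inl hA

/-- The `ℓ_p` norm of a finite family of real numbers. -/
def finLpNorm {ι : Type*} [Fintype ι] (p : ℝ) (v : ι → ℝ) : ℝ := (∑ i, |v i| ^ p) ^ (1 / p)

theorem finLpNorm_nonneg {ι : Type*} [Fintype ι] (p : ℝ) (v : ι → ℝ) : 0 ≤ finLpNorm p v :=
  Real.rpow_nonneg (Finset.sum_nonneg fun _ _ => Real.rpow_nonneg (abs_nonneg _) _) _

/-- Every map from `α` to `ℓ_p^ι` induces a pseudometric on `α` which admits a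
`(β, Δ)`-Lipschitz decomposition for all `Δ > 0`. -/
def LpDecomposable (α ι : Type*) [Fintype ι] (p β : ℝ) : Prop :=
  ∀ (F : α → ι → ℝ) (Δ : ℝ), 0 < Δ → ∃ D : PMF (Setoid α),
    (∀ R ∈ D.support, ∀ x y, R.r x y → finLpNorm p (F x - F y) ≤ Δ) ∧
    ∀ x y, D.toOuterMeasure {R | ¬ R.r x y} ≤ ENNReal.ofReal (β * finLpNorm p (F x - F y) / Δ)

theorem LpDecomposable.mono {α ι : Type*} [Fintype ι] {p β β' : ℝ}
    (h : LpDecomposable α ι p β) (hβ : β ≤ β') : LpDecomposable α ι p β' := by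
  intro F Δ hΔ
  obtain ⟨D, hD, hsep⟩ := h F Δ hΔ
  refine ⟨D, hD, fun x y => (hsep x y).trans (ENNReal.ofReal_le_ofReal ?_)⟩
  have := finLpNorm_nonneg p (F x - F y)
  gcongr

/-- If balls of `ℓ_p` are mapped to `ℓ_q` in a Lipschitz way with Hölder inverse, decompositions of
subsets of `ℓ_q` can be pulled back: each cluster of diameter `2Δ` in `ℓ_p` is refined by pulling
back a decomposition of its image, starting from a trivial partition at a large scale. -/
theorem LpDecomposable.of_map {α ι : Type*} [Finite α] [Fintype ι] {p q s A B β : ℝ}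
    (hs : 1 ≤ s) (hA : 0 ≤ A) (hB : 0 < B) (hβ : 0 ≤ β) (G : (ι → ℝ) → (ι → ℝ))
    (hlip : ∀ (v w : ι → ℝ) (r : ℝ), finLpNorm p v ≤ r → finLpNorm p w ≤ r →
      finLpNorm q (G v - G w) ≤ A * r ^ (s - 1) * finLpNorm p (v - w))
    (hinv : ∀ v w : ι → ℝ, finLpNorm p (v - w) ^ s ≤ B * finLpNorm q (G v - G w))
    (h : LpDecomposable α ι q β) : LpDecomposable α ι p (A * B * 2 ^ s * β) := by
  classical
  intro F Δ₀ hΔ₀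
  suffices H : ∀ (T : ℕ) (Δ : ℝ), 0 < Δ → (∀ x y, finLpNorm p (F x - F y) ≤ 2 ^ T * Δ) →
      ∃ D : PMF (Setoid α),
        (∀ R ∈ D.support, ∀ x y, R.r x y → finLpNorm p (F x - F y) ≤ Δ) ∧
        ∀ x y, D.toOuterMeasure {R | ¬ R.r x y} ≤
          ENNReal.ofReal (A * B * 2 ^ s * β * finLpNorm p (F x - F y) / Δ) by
    obtain ⟨M, hM⟩ := Set.Finite.bddAbove
      (Set.finite_range fun xy : α × α => finLpNorm p (F xy.1 - F xy.2))
    obtain ⟨T, hT⟩ := pow_unbounded_of_one_lt (M / Δ₀) one_lt_two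
    refine H T Δ₀ hΔ₀ fun x y => (hM ⟨(x, y), rfl⟩).trans ?_
    exact ((div_lt_iff₀ hΔ₀).1 hT).le
  intro T
  induction T with
  | zero =>
    intro Δ _ hF
    refine ⟨PMF.pure ⊤, fun R _ x y _ => by simpa using hF x y, fun x y => ?_⟩
    simp [PMF.toOuterMeasure_pure_apply, show (⊤ : Setoid α) x y from trivial]
  | succ T ih =>
    intro Δ hΔ hF
    obtain ⟨D, hD, hDsep⟩ := ih (2 * Δ) (by positivity) fun x y =>
      (hF x y).trans (le_of_eq (by ring))
    let rep : Setoid α → α → α := fun R x => (Quotient.mk R x).out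
    have hrep : ∀ (R : Setoid α) x, R.r x (rep R x) := fun R x =>
      R.symm (Quotient.exact (Quotient.out_eq (Quotient.mk R x)))
    have hrep_eq : ∀ (R : Setoid α) x y, R.r x y → rep R x = rep R y := fun R x y hxy =>
      congrArg Quotient.out (Quotient.sound hxy)
    have hΔ' : 0 < Δ ^ s / B := by positivity
    choose g hg hgsep using fun R : Setoid α =>
      h (fun x => G (F x - F (rep R x))) (Δ ^ s / B) hΔ'
    refine ⟨D.bind fun R => (g R).map fun R' => R ⊓ R', ?_, ?_⟩
    · intro R hR x y hxy
      simp only [PMF.mem_support_bind_iff, PMF.mem_support_map_iff] at hR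
      obtain ⟨R₁, -, R₂, hR₂, rfl⟩ := hR
      obtain ⟨h1, h2⟩ : R₁.r x y ∧ R₂.r x y := hxy
      have h3 := hg R₁ R₂ hR₂ x y h2
      have h4 := hinv (F x - F (rep R₁ x)) (F y - F (rep R₁ y))
      rw [hrep_eq R₁ x y h1] at h3 h4
      rw [sub_sub_sub_cancel_right] at h4
      have h5 : finLpNorm p (F x - F y) ^ s ≤ Δ ^ s := by
        refine h4.trans ((mul_le_mul_of_nonneg_left h3 hB.le).trans (le_of_eq ?_))
        field_simp
      exact (Real.rpow_le_rpow_iff (finLpNorm_nonneg _ _) hΔ.le (by linarith)).1 h5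
    · intro x y
      set N := finLpNorm p (F x - F y) with hN
      have hN0 : 0 ≤ N := finLpNorm_nonneg _ _
      set K := A * B * 2 ^ s * β with hK
      have hK0 : 0 ≤ K := by positivity
      have key : ∀ R, D R * ((g R).map fun R' => R ⊓ R').toOuterMeasure {R | ¬ R.r x y} ≤
          Set.indicator {R | ¬ R.r x y} D R + D R * ENNReal.ofReal (K * N / (2 * Δ)) := by
        intro R
        by_cases hR : R ∈ D.support
        swap
        · rw [PMF.mem_support_iff, not_not] at hR
          simp [hR]
        by_cases hxy : R.r x y
        · refine le_add_left ?_
          gcongr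
          rw [PMF.toOuterMeasure_map_apply]
          have : (fun R' => R ⊓ R') ⁻¹' {R | ¬ R.r x y} = {R' : Setoid α | ¬ R'.r x y} := by
            ext R'
            change ¬ (R.r x y ∧ R'.r x y) ↔ ¬ R'.r x y
            tauto
          rw [this]
          refine (hgsep R x y).trans (ENNReal.ofReal_le_ofReal ?_)
          have h1 := hlip (F x - F (rep R x)) (F y - F (rep R y)) (2 * Δ)
            (hD R hR _ _ (hrep R x)) (hD R hR _ _ (hrep R y))
          rw [hrep_eq R x y hxy, sub_sub_sub_cancel_right, ← hN] at h1
          rw [hrep_eq R x y hxy]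
          have h2 : (2 * Δ) ^ (s - 1) = 2 ^ s * Δ ^ s / (2 * Δ) := by
            rw [Real.rpow_sub (by positivity), Real.rpow_one,
              Real.mul_rpow (by positivity) hΔ.le]
          rw [div_le_iff₀ hΔ']
          calc _ ≤ β * (A * (2 * Δ) ^ (s - 1) * N) := by gcongr
            _ = _ := by
              rw [h2, hK]
              field_simp
        · refine le_add_right ?_
          rw [Set.indicator_of_mem (by exact hxy)]
          calc _ ≤ D R * 1 := by
                gcongr
                exact (((g R).map _).toOuterMeasure.mono (Set.subset_univ _)).trans
                  ((PMF.toOuterMeasure_apply_eq_one_iff _ _).2 (Set.subset_univ _)).le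
            _ = D R := mul_one _
      rw [PMF.toOuterMeasure_bind_apply]
      calc _ ≤ ∑' R, (Set.indicator {R | ¬ R.r x y} D R +
              D R * ENNReal.ofReal (K * N / (2 * Δ))) := ENNReal.tsum_le_tsum key
        _ = D.toOuterMeasure {R | ¬ R.r x y} + ENNReal.ofReal (K * N / (2 * Δ)) := by
            rw [ENNReal.tsum_add, ENNReal.tsum_mul_right, PMF.tsum_coe, one_mul,
              PMF.toOuterMeasure_apply]
        _ ≤ ENNReal.ofReal (K * N / (2 * Δ)) + ENNReal.ofReal (K * N / (2 * Δ)) := by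
            gcongr
            exact hDsep x y
        _ = ENNReal.ofReal (K * N / Δ) := by
            rw [← ENNReal.ofReal_add (by positivity) (by positivity)]
            congr 1
            field_simp
            ring

/-- The coordinatewise signed power map, mapping `ℓ_p` to `ℓ_{p / (1 + t)}`. -/
def mazurMap {ι : Type*} (t : ℝ) (v : ι → ℝ) (i : ι) : ℝ := v i * |v i| ^ t

theorem abs_mul_abs_rpow_sub_le {t : ℝ} (ht : 0 < t) (ht1 : t ≤ 1) (a b : ℝ) :
    |a * |a| ^ t - b * |b| ^ t| ≤ 2 * ((|a| + |b|) ^ t * |a - b|) := by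
  wlog h : |b| ≤ |a| generalizing a b
  · have := this b a (le_of_not_ge h)
    rwa [abs_sub_comm, abs_sub_comm b a, add_comm |b|] at this
  have ha := abs_nonneg a
  have hb := abs_nonneg b
  have hbt : |b| ^ t ≤ |a| ^ t := by gcongr
  have hat : |a| ^ t ≤ (|a| + |b|) ^ t := by gcongr; linarith
  have hat0 : 0 ≤ |a| ^ t := by positivity
  have h1 : |b| * (|a| ^ t - |b| ^ t) ≤ |a| ^ t * (|a| - |b|) := by
    rcases ha.eq_or_lt with h0 | hpos
    · have : |b| = 0 := by linarith
      simp [this, ← h0]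
    have h2 : |b| / |a| ≤ (|b| / |a|) ^ t := by
      have := Real.rpow_le_rpow_of_exponent_ge' (by positivity) ((div_le_one hpos).2 h) ht.le ht1
      simpa using this
    rw [Real.div_rpow hb ha, div_le_div_iff₀ hpos (by positivity)] at h2
    refine le_of_mul_le_mul_right ?_ hpos
    nlinarith [mul_nonneg hat0 (sq_nonneg (|a| - |b|)), mul_le_mul_of_nonneg_left h2 hb]
  have h3 : |a| - |b| ≤ |a - b| := abs_sub_abs_le_abs_sub a b
  calc |a * |a| ^ t - b * |b| ^ t| = |(a - b) * |a| ^ t + b * (|a| ^ t - |b| ^ t)| := by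
        congr 1
        ring
    _ ≤ |a - b| * |a| ^ t + |b| * (|a| ^ t - |b| ^ t) := by
        refine (abs_add_le _ _).trans (le_of_eq ?_)
        rw [abs_mul, abs_mul, abs_of_nonneg hat0, abs_of_nonneg (sub_nonneg.2 hbt)]
    _ ≤ |a - b| * |a| ^ t + |a| ^ t * |a - b| := by
        have := h1.trans (mul_le_mul_of_nonneg_left h3 hat0)
        linarith
    _ = 2 * (|a| ^ t * |a - b|) := by ring
    _ ≤ _ := by gcongr

theorem abs_mul_abs_sub_le (a b : ℝ) :
    |a * |a| ^ (1 : ℝ) - b * |b| ^ (1 : ℝ)| ≤ 1 * ((|a| + |b|) ^ (1 : ℝ) * |a - b|) := by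
  simp only [Real.rpow_one, one_mul]
  rcases abs_cases a with ⟨h1, h1'⟩ | ⟨h1, h1'⟩ <;> rcases abs_cases b with ⟨h2, h2'⟩ | ⟨h2, h2'⟩ <;>
    rw [h1, h2] <;> rcases abs_cases (a - b) with ⟨h3, h3'⟩ | ⟨h3, h3'⟩ <;> rw [h3, abs_le] <;>
    constructor <;> nlinarith

theorem abs_sub_rpow_le {t : ℝ} (ht : 0 ≤ t) (a b : ℝ) :
    |a - b| ^ (1 + t) ≤ 2 ^ t * |a * |a| ^ t - b * |b| ^ t| := by
  have hpow : ∀ x : ℝ, 0 ≤ x → x * x ^ t = x ^ (1 + t) := fun x hx => by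
    rw [Real.rpow_add_of_nonneg hx zero_le_one ht, Real.rpow_one]
  have htwo : (1 : ℝ) ≤ 2 ^ t := Real.one_le_rpow one_le_two ht
  wlog hab : |b| ≤ |a| generalizing a b
  · have := this b a (le_of_not_ge hab)
    rwa [abs_sub_comm, abs_sub_comm (b * _)] at this
  wlog ha : 0 ≤ a generalizing a b
  · have := this (-a) (-b) (by simpa using hab) (by linarith)
    have e1 : -a - -b = -(a - b) := by ring
    have e2 : -a * |-a| ^ t - -b * |-b| ^ t = -(a * |a| ^ t - b * |b| ^ t) := by
      rw [abs_neg, abs_neg]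
      ring
    rw [e1, e2, abs_neg, abs_neg] at this
    exact this
  rw [abs_of_nonneg ha] at hab ⊢
  rcases le_total 0 b with hb | hb
  · rw [abs_of_nonneg hb] at hab ⊢
    rw [hpow a ha, hpow b hb, abs_of_nonneg (sub_nonneg.2 hab)]
    have h := Real.add_rpow_le_rpow_add (sub_nonneg.2 hab) hb (p := 1 + t) (by linarith)
    rw [sub_add_cancel] at h
    have h0 : 0 ≤ (a - b) ^ (1 + t) := Real.rpow_nonneg (sub_nonneg.2 hab) _
    rw [abs_of_nonneg (by linarith)]
    nlinarith
  · rw [abs_of_nonpos hb] at hab ⊢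
    have hb' : 0 ≤ -b := by linarith
    have h1 : b * (-b) ^ t = -(-b) ^ (1 + t) := by
      rw [← hpow _ hb']
      ring
    have ha0 := Real.rpow_nonneg ha (1 + t)
    have hb0 := Real.rpow_nonneg hb' (1 + t)
    rw [h1, hpow a ha, abs_of_nonneg (by linarith), abs_of_nonneg (by linarith)]
    have h := NNReal.rpow_add_le_mul_rpow_add_rpow a.toNNReal (-b).toNNReal (p := 1 + t) (by linarith)
    have h' := NNReal.coe_le_coe.2 h
    push_cast at h'
    rw [Real.coe_toNNReal _ ha, Real.coe_toNNReal _ hb', show 1 + t - 1 = t by ring] at h'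
    simpa [sub_eq_add_neg] using h'

section FinLpNorm

variable {ι : Type*} [Fintype ι]

theorem finLpNorm_add_le {p : ℝ} (hp : 1 ≤ p) (v w : ι → ℝ) :
    finLpNorm p (fun i => |v i| + |w i|) ≤ finLpNorm p v + finLpNorm p w := by
  simpa [finLpNorm] using Real.Lp_add_le Finset.univ (fun i => |v i|) (fun i => |w i|) hp

theorem finLpNorm_mazurMap_sub_le {t q K : ℝ} (ht : 0 < t) (hq : 1 ≤ q) (hK : 0 ≤ K)
    (hG : ∀ a b : ℝ, |a * |a| ^ t - b * |b| ^ t| ≤ K * ((|a| + |b|) ^ t * |a - b|))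
    (v w : ι → ℝ) (r : ℝ) (hv : finLpNorm (q * (1 + t)) v ≤ r)
    (hw : finLpNorm (q * (1 + t)) w ≤ r) :
    finLpNorm q (mazurMap t v - mazurMap t w) ≤
      K * 2 ^ t * r ^ t * finLpNorm (q * (1 + t)) (v - w) := by
  have hq0 : 0 < q := by linarith
  set p := q * (1 + t) with hp
  have hp0 : 0 < p := by positivity
  have hp1 : 1 ≤ p := by nlinarith
  have hr : 0 ≤ r := (finLpNorm_nonneg _ _).trans hv
  let u : ι → ℝ := fun i => |v i| + |w i|
  have hu : ∀ i, 0 ≤ u i := fun i => by positivity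
  have hhol : Real.HolderTriple (p / t) p q :=
    ⟨by rw [hp]; field_simp; ring, by positivity, hp0⟩
  have h1 : ∑ i, (u i ^ t * |v i - w i|) ^ q ≤
      (∑ i, u i ^ p) ^ (q / (p / t)) * (∑ i, |v i - w i| ^ p) ^ (q / p) := by
    have := Real.Lr_rpow_le_Lp_mul_Lq_of_nonneg Finset.univ (f := fun i => u i ^ t)
      (g := fun i => |v i - w i|) hhol (fun i _ => Real.rpow_nonneg (hu i) _)
      (fun i _ => abs_nonneg _)
    refine this.trans (le_of_eq ?_)
    congr 3
    funext i
    rw [← Real.rpow_mul (hu i)]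
    congr 1
    field_simp
  have hU0 : 0 ≤ ∑ i, u i ^ p := Finset.sum_nonneg fun i _ => Real.rpow_nonneg (hu i) _
  have hV0 : 0 ≤ ∑ i, |v i - w i| ^ p :=
    Finset.sum_nonneg fun i _ => Real.rpow_nonneg (abs_nonneg _) _
  have hu2 : finLpNorm p u ≤ 2 * r := (finLpNorm_add_le hp1 v w).trans (by linarith)
  have hS0 : 0 ≤ ∑ i, (u i ^ t * |v i - w i|) ^ q := Finset.sum_nonneg fun i _ =>
    Real.rpow_nonneg (mul_nonneg (Real.rpow_nonneg (hu i) _) (abs_nonneg _)) _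
  calc finLpNorm q (mazurMap t v - mazurMap t w)
      ≤ (∑ i, K ^ q * (u i ^ t * |v i - w i|) ^ q) ^ (1 / q) := by
        unfold finLpNorm
        gcongr with i
        rw [← Real.mul_rpow hK (mul_nonneg (Real.rpow_nonneg (hu i) _) (abs_nonneg _))]
        gcongr
        exact hG (v i) (w i)
    _ = K * (∑ i, (u i ^ t * |v i - w i|) ^ q) ^ (1 / q) := by
        rw [← Finset.mul_sum, Real.mul_rpow (by positivity) hS0, ← Real.rpow_mul hK,
          mul_one_div_cancel hq0.ne', Real.rpow_one]
    _ ≤ K * ((∑ i, u i ^ p) ^ (q / (p / t)) * (∑ i, |v i - w i| ^ p) ^ (q / p)) ^ (1 / q) := by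
        gcongr
    _ = K * (finLpNorm p u ^ t * finLpNorm p (v - w)) := by
        rw [Real.mul_rpow (Real.rpow_nonneg hU0 _) (Real.rpow_nonneg hV0 _),
          ← Real.rpow_mul hU0, ← Real.rpow_mul hV0]
        unfold finLpNorm
        simp only [abs_of_nonneg (hu _), Pi.sub_apply]
        rw [← Real.rpow_mul hU0]
        congr 3
        · field_simp
        · field_simp
    _ ≤ K * ((2 * r) ^ t * finLpNorm p (v - w)) := by
        have := finLpNorm_nonneg p u
        have := finLpNorm_nonneg p (v - w)
        gcongr
    _ = _ := by
        rw [Real.mul_rpow zero_le_two hr]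
        ring

theorem finLpNorm_sub_rpow_le {t q : ℝ} (ht : 0 ≤ t) (hq : 1 ≤ q) (v w : ι → ℝ) :
    finLpNorm (q * (1 + t)) (v - w) ^ (1 + t) ≤
      2 ^ t * finLpNorm q (mazurMap t v - mazurMap t w) := by
  have hq0 : 0 < q := by linarith
  have h0 : ∀ (r : ℝ) (z : ι → ℝ), 0 ≤ ∑ i, |z i| ^ r := fun r z =>
    Finset.sum_nonneg fun _ _ => Real.rpow_nonneg (abs_nonneg _) _
  unfold finLpNorm
  rw [← Real.rpow_mul (h0 _ _), show 1 / (q * (1 + t)) * (1 + t) = 1 / q by field_simp]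
  calc (∑ i, |(v - w) i| ^ (q * (1 + t))) ^ (1 / q)
      ≤ (∑ i, (2 ^ t) ^ q * |(mazurMap t v - mazurMap t w) i| ^ q) ^ (1 / q) := by
        gcongr with i
        rw [← Real.mul_rpow (by positivity) (abs_nonneg _), mul_comm q,
          Real.rpow_mul (abs_nonneg _)]
        gcongr
        exact abs_sub_rpow_le ht (v i) (w i)
    _ = _ := by
        rw [← Finset.mul_sum, Real.mul_rpow (by positivity) (h0 _ _),
          ← Real.rpow_mul (by positivity), mul_one_div_cancel hq0.ne', Real.rpow_one]

theorem LpDecomposable.mazur {α : Type*} [Finite α] {t q K β : ℝ} (ht : 0 < t) (hq : 1 ≤ q)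
    (hK : 0 ≤ K) (hβ : 0 ≤ β)
    (hG : ∀ a b : ℝ, |a * |a| ^ t - b * |b| ^ t| ≤ K * ((|a| + |b|) ^ t * |a - b|))
    (h : LpDecomposable α ι q β) :
    LpDecomposable α ι (q * (1 + t)) (K * 2 ^ t * 2 ^ t * 2 ^ (1 + t) * β) := by
  refine h.of_map (s := 1 + t) (by linarith) (by positivity) (by positivity) hβ (mazurMap t) ?_
    (finLpNorm_sub_rpow_le ht.le hq)
  simpa only [add_sub_cancel_left] using finLpNorm_mazurMap_sub_le ht hq hK hG

/-- Doubling the exponent multiplies the decomposition parameter by at most `16`. -/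
theorem LpDecomposable.double {α : Type*} [Finite α] {p β : ℝ} (hp : 2 ≤ p) (hβ : 0 ≤ β)
    (h : LpDecomposable α ι (p / 2) β) : LpDecomposable α ι p (16 * β) := by
  have := h.mazur one_pos (by linarith) zero_le_one hβ abs_mul_abs_sub_le
  rw [show p / 2 * (1 + 1) = p by ring] at this
  refine this.mono (le_of_eq ?_)
  norm_num

theorem LpDecomposable.of_two {α : Type*} [Finite α] {p β : ℝ} (hp : 2 ≤ p) (hp4 : p ≤ 4)
    (hβ : 0 ≤ β) (h : LpDecomposable α ι 2 β) : LpDecomposable α ι p (32 * β) := by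
  rcases hp.eq_or_lt with rfl | hp
  · exact h.mono (by linarith)
  have := h.mazur (t := p / 2 - 1) (by linarith) one_le_two zero_le_two hβ
    (abs_mul_abs_rpow_sub_le (by linarith) (by linarith))
  rw [show 2 * (1 + (p / 2 - 1)) = p by ring] at this
  refine this.mono ?_
  have h1 : (2 : ℝ) ^ (p / 2 - 1) ≤ 2 := by
    simpa using Real.rpow_le_rpow_of_exponent_le one_le_two (show p / 2 - 1 ≤ 1 by linarith)
  have h2 : (2 : ℝ) ^ (1 + (p / 2 - 1)) ≤ 4 := by
    have := Real.rpow_le_rpow_of_exponent_le one_le_two (show 1 + (p / 2 - 1) ≤ 2 by linarith)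
    norm_num at this ⊢
    exact this
  calc _ ≤ 2 * 2 * 2 * 4 * β := by gcongr
    _ = 32 * β := by ring

theorem LpDecomposable.of_two_of_le {α : Type*} [Finite α] {β : ℝ} (hβ : 0 ≤ β)
    (h : LpDecomposable α ι 2 β) {p : ℝ} (hp : 2 ≤ p) : LpDecomposable α ι p (2 * p ^ 4 * β) := by
  suffices H : ∀ (k : ℕ) (p : ℝ), 2 ≤ p → p ≤ 2 ^ k * 4 →
      LpDecomposable α ι p (2 * p ^ 4 * β) by
    obtain ⟨k, hk⟩ := pow_unbounded_of_one_lt p one_lt_two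
    exact H k p hp (by linarith)
  intro k
  induction k with
  | zero =>
    intro p hp hp4
    refine (h.of_two hp (by linarith) hβ).mono ?_
    have : (2 : ℝ) ^ 4 ≤ p ^ 4 := by gcongr
    nlinarith
  | succ k ih =>
    intro p hp hpk
    rcases le_or_gt p 4 with hp4 | hp4
    · refine (h.of_two hp hp4 hβ).mono ?_
      have : (2 : ℝ) ^ 4 ≤ p ^ 4 := by gcongr
      nlinarith
    · refine ((ih (p / 2) (by linarith) (by rw [pow_succ] at hpk; linarith)).double hp
        (by positivity)).mono (le_of_eq ?_)
      ring

/-- A random partition of a finite Euclidean point set with the optimal dependence on the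
number of points. -/
theorem LpDecomposable.two {α : Type*} [Fintype α] {n : ℕ} (hn : 2 ≤ n)
    (hα : Fintype.card α ≤ n) : LpDecomposable α ι 2 (32 * Real.sqrt (Real.log n)) := by
  intro F Δ hΔ
  have hn' : (2 : ℝ) ≤ n := by exact_mod_cast hn
  have hlog : 0 < Real.log n := Real.log_pos (by linarith)
  set L := Real.sqrt (Real.log n) with hL
  have hL0 : 0 < L := Real.sqrt_pos.2 hlog
  have hL2 : L ^ 2 = Real.log n := Real.sq_sqrt hlog.le
  have hnorm : ∀ v : ι → ℝ, ‖(WithLp.toLp 2 v : EuclideanSpace ℝ ι)‖ = finLpNorm 2 v := by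
    intro v
    rw [EuclideanSpace.norm_eq, finLpNorm, Real.sqrt_eq_rpow]
    simp
  let c : ℝ := 8 * L / Δ
  have hc : 0 < c := by positivity
  have hdist : ∀ x y, ‖c • (WithLp.toLp 2 (F x) : EuclideanSpace ℝ ι) -
      c • (WithLp.toLp 2 (F y) : EuclideanSpace ℝ ι)‖ = c * finLpNorm 2 (F x - F y) := by
    intro x y
    rw [← smul_sub, norm_smul, ← WithLp.toLp_sub, hnorm, Real.norm_of_nonneg hc.le]
  have hcard : Fintype.card α * Real.exp (-(8 * L / 2) ^ 2 / 8) ≤ 1 / 2 := by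
    have h1 : -(8 * L / 2) ^ 2 / 8 = -(Real.log n + Real.log n) := by
      rw [← hL2]
      ring
    have hα' : (Fintype.card α : ℝ) ≤ n := by exact_mod_cast hα
    rw [h1, Real.exp_neg, Real.exp_add, Real.exp_log (by linarith), ← div_eq_mul_inv,
      div_le_div_iff₀ (by positivity) two_pos]
    nlinarith
  obtain ⟨D, hD, hsep⟩ := exists_pmf_setoid_euclidean
    (fun x => c • (WithLp.toLp 2 (F x) : EuclideanSpace ℝ ι)) (8 * L) (by positivity) hcard
  refine ⟨D, fun R hR x y hxy => ?_, fun x y => (hsep x y).trans (le_of_eq ?_)⟩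
  · have := hD R hR x y hxy
    rw [hdist] at this
    refine le_of_mul_le_mul_left (this.trans (le_of_eq ?_)) hc
    simp only [c]
    field_simp
  · rw [hdist]
    congr 1
    simp only [c]
    ring

end FinLpNorm

/-- Finitely many points of `ℓ_p` can be projected onto finitely many coordinates
with distortion at most `2`. -/
theorem exists_finLpNorm_truncation {p : ℝ} (hp : 0 < p) [Fact (1 ≤ ENNReal.ofReal p)]
    {α : Type*} [Finite α] (f : α → lp (fun _ : ℕ => ℝ) (ENNReal.ofReal p)) :
    ∃ N : ℕ, ∀ x, finLpNorm p (fun i : Fin N => f x i) ≤ ‖f x‖ ∧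
      ‖f x‖ ≤ 2 * finLpNorm p (fun i : Fin N => f x i) := by
  have htoReal : (ENNReal.ofReal p).toReal = p := ENNReal.toReal_ofReal hp.le
  have hpos : 0 < (ENNReal.ofReal p).toReal := by rwa [htoReal]
  have hfin : ∀ (N : ℕ) (x : α), finLpNorm p (fun i : Fin N => f x i) =
      (∑ i ∈ Finset.range N, ‖f x i‖ ^ p) ^ (1 / p) := by
    intro N x
    rw [finLpNorm, Finset.sum_range]
    rfl
  have hsum : ∀ x, HasSum (fun i => ‖f x i‖ ^ p) (‖f x‖ ^ p) := by
    intro x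
    have := lp.hasSum_norm hpos (f x)
    rwa [htoReal] at this
  have hle : ∀ (N : ℕ) (x : α), finLpNorm p (fun i : Fin N => f x i) ≤ ‖f x‖ := by
    intro N x
    rw [hfin]
    calc _ ≤ (‖f x‖ ^ p) ^ (1 / p) := by
          gcongr
          exact sum_le_hasSum _ (fun _ _ => by positivity) (hsum x)
      _ = ‖f x‖ := by
          rw [← Real.rpow_mul (norm_nonneg _), mul_one_div_cancel hp.ne', Real.rpow_one]
  have hev : ∀ x, ∀ᶠ N : ℕ in Filter.atTop,
      ‖f x‖ ≤ 2 * finLpNorm p (fun i : Fin N => f x i) := by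
    intro x
    rcases (norm_nonneg (f x)).eq_or_lt with h0 | h0
    · filter_upwards with N
      have := finLpNorm_nonneg p (fun i : Fin N => f x i)
      linarith
    have ht : Filter.Tendsto (fun N : ℕ => finLpNorm p (fun i : Fin N => f x i)) Filter.atTop
        (nhds ‖f x‖) := by
      simp only [hfin]
      have := (hsum x).tendsto_sum_nat.rpow_const (p := 1 / p) (Or.inr (by positivity))
      rwa [← Real.rpow_mul (norm_nonneg _), mul_one_div_cancel hp.ne', Real.rpow_one] at this
    filter_upwards [ht.eventually_const_le (show ‖f x‖ / 2 < ‖f x‖ by linarith)] with N hN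
    linarith
  obtain ⟨N, hN⟩ := (Filter.eventually_all.2 hev).exists
  exact ⟨N, fun x => ⟨hle N x, hN x⟩⟩

/-- There is a universal constant `C > 0` such that for every real `p ≥ 2`, every integer
`n ≥ 2`, every `n`-point subset `M` of the sequence space `ℓ_p`, and every `Δ > 0`, the
metric space `M` admits a `(C * p^4 * √(log n), Δ)`-Lipschitz decomposition. -/
theorem lipschitz_decomposition_lp :
    ∃ C : ℝ, 0 < C ∧
      ∀ (p : ℝ), 2 ≤ p →
      ∀ [Fact (1 ≤ ENNReal.ofReal p)],
      ∀ (n : ℕ), 2 ≤ n →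
      ∀ (M : Set (lp (fun _ : ℕ => ℝ) (ENNReal.ofReal p))),
        M.Finite → M.ncard = n →
        ∀ Δ : ℝ, 0 < Δ →
          LipschitzDecomp M (C * p ^ 4 * Real.sqrt (Real.log n)) Δ := by
  refine ⟨128, by norm_num, ?_⟩
  intro p hp _ n hn M hM hcard Δ hΔ
  have : Fintype M := hM.fintype
  have hα : Fintype.card M ≤ n := by
    rw [← hcard, ← Nat.card_eq_fintype_card, Nat.card_coe_set_eq]
  set L := Real.sqrt (Real.log n)
  have hL : 0 ≤ L := Real.sqrt_nonneg _
  obtain ⟨N, hN⟩ := exists_finLpNorm_truncation (show 0 < p by linarith)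
    fun xy : M × M => (xy.1 - xy.2 : lp (fun _ : ℕ => ℝ) (ENNReal.ofReal p))
  have hdec := LpDecomposable.of_two_of_le (α := M) (ι := Fin N) (β := 32 * L) (by positivity)
    (LpDecomposable.two hn hα) hp
  obtain ⟨D, hD, hsep⟩ := hdec
    (fun x i => (x : lp (fun _ : ℕ => ℝ) (ENNReal.ofReal p)) i) (Δ / 2) (by positivity)
  have hN' : ∀ x y : M, finLpNorm p ((fun i : Fin N =>
      (x : lp (fun _ : ℕ => ℝ) (ENNReal.ofReal p)) i) - fun i : Fin N =>
      (y : lp (fun _ : ℕ => ℝ) (ENNReal.ofReal p)) i) ≤ dist x y ∧ dist x y ≤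
      2 * finLpNorm p ((fun i : Fin N =>
      (x : lp (fun _ : ℕ => ℝ) (ENNReal.ofReal p)) i) - fun i : Fin N =>
      (y : lp (fun _ : ℕ => ℝ) (ENNReal.ofReal p)) i) := by
    intro x y
    rw [Subtype.dist_eq, dist_eq_norm]
    exact hN (x, y)
  refine ⟨D, fun R hR x y hxy => ?_, fun x y => (hsep x y).trans ?_⟩
  · have := hD R hR x y hxy
    linarith [(hN' x y).2]
  · refine ENNReal.ofReal_le_ofReal ?_
    calc _ ≤ 2 * p ^ 4 * (32 * L) * dist x y / (Δ / 2) := by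
          gcongr
          exact (hN' x y).1
      _ = 128 * p ^ 4 * L * dist x y / Δ := by
          field_simp
          ring
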